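/- Let u and v be false twins in a connected graph G. If G − u admits a strong conflict-free vertex-connection k-coloring, then G admits a strong conflict-free vertex-connection k-coloring. (Indeed, extending a strong cfvc k-coloring f of G − u by setting f(u) := f(v) yields a strong cfvc k-coloring of G.) -/

import Mathlib

/-- A walk in a vertex-colored graph is conflict-free if some color appears on
exactly one vertex of the walk. -/
def ConflictFree {V α : Type*} {G : SimpleGraph V} (f : V → α) {u v : V}
    (p : G.Walk u v) : Prop :=
  ∃ c : α, ∃! x, x ∈ p.support ∧ f x = c

/-- A coloring `f` is a strong conflict-free vertex-connection coloring if every two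
distinct vertices are joined by a conflict-free shortest path. -/
def IsStrongCfvc {V α : Type*} (G : SimpleGraph V) (f : V → α) : Prop :=
  ∀ u v : V, u ≠ v →
    ∃ p : G.Walk u v, p.IsPath ∧ p.length = G.dist u v ∧ ConflictFree f p

/-- If `r` retracts `G` onto the image of `φ : H →g G`, then conflict-free shortest paths of `H`
map along `φ` to conflict-free shortest paths of `G` for the coloring pulled back along `r`. -/
theorem IsStrongCfvc.exists_path_of_leftInverse {V W α : Type*} {G : SimpleGraph V}
    {H : SimpleGraph W} {f : W → α} (hf : IsStrongCfvc H f) (φ : H →g G) (r : G →g H)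
    (hr : Function.LeftInverse r φ) {a b : W} (hab : a ≠ b) :
    ∃ p : G.Walk (φ a) (φ b),
      p.IsPath ∧ p.length = G.dist (φ a) (φ b) ∧ ConflictFree (f ∘ r) p := by
  obtain ⟨p, hp, hlen, c, x, ⟨hx, hxc⟩, hx_unique⟩ := hf a b hab
  refine ⟨p.map φ, hp.map hr.injective, le_antisymm ?_ (SimpleGraph.dist_le _), c, φ x, ?_, ?_⟩
  · obtain ⟨q, hq⟩ := (p.map φ).reachable.exists_walk_length_eq_dist
    have h := SimpleGraph.dist_le ((q.map r).copy (hr a) (hr b))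
    rw [SimpleGraph.Walk.length_copy, SimpleGraph.Walk.length_map] at h
    rw [SimpleGraph.Walk.length_map]
    omega
  · refine ⟨?_, by simpa [hr x] using hxc⟩
    rw [SimpleGraph.Walk.support_map]
    exact List.mem_map_of_mem hx
  · rintro y ⟨hy, hyc⟩
    rw [SimpleGraph.Walk.support_map] at hy
    obtain ⟨z, hz, rfl⟩ := List.mem_map.1 hy
    rw [hx_unique z ⟨hz, by simpa [hr z] using hyc⟩]

/-- A strong conflict-free vertex-connection coloring is proper. -/
theorem IsStrongCfvc.ne_of_adj {V α : Type*} {G : SimpleGraph V} {f : V → α}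
    (hf : IsStrongCfvc G f) {a b : V} (hab : G.Adj a b) : f a ≠ f b := by
  intro h
  obtain ⟨p, -, hlen, c, x, ⟨hx, hxc⟩, hx_unique⟩ := hf a b hab.ne
  rw [SimpleGraph.dist_eq_one_iff_adj.2 hab] at hlen
  have hx_end : x = a ∨ x = b := by
    cases p with
    | nil => simp at hlen
    | cons _ q =>
      cases q with
      | nil => simpa using hx
      | cons _ _ => simp at hlen
  have hac : f a = c := by
    rcases hx_end with rfl | rfl
    · exact hxc
    · exact h.trans hxc
  exact hab.ne ((hx_unique a ⟨p.start_mem_support, hac⟩).trans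
    (hx_unique b ⟨p.end_mem_support, h ▸ hac⟩).symm)

/-- Two non-adjacent vertices with a common neighbor of a different color are joined by a
conflict-free shortest path. -/
theorem exists_path_of_common_neighbor {V α : Type*} {G : SimpleGraph V} {g : V → α}
    {a b w : V} (hab : a ≠ b) (hnadj : ¬ G.Adj a b) (haw : G.Adj a w) (hwb : G.Adj w b)
    (ha : g a ≠ g w) (hb : g b ≠ g w) :
    ∃ p : G.Walk a b, p.IsPath ∧ p.length = G.dist a b ∧ ConflictFree g p := by
  refine ⟨.cons haw (.cons hwb .nil), ?_, ?_, g w, w, by simp, ?_⟩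
  · simp [haw.ne, hwb.ne, hab]
  · have hle := SimpleGraph.dist_le (SimpleGraph.Walk.cons haw (.cons hwb .nil))
    have hpos := (haw.reachable.trans hwb.reachable).pos_dist_of_ne hab
    have hne : G.dist a b ≠ 1 := fun h => hnadj (SimpleGraph.dist_eq_one_iff_adj.1 h)
    simp only [SimpleGraph.Walk.length_cons, SimpleGraph.Walk.length_nil] at hle ⊢
    omega
  · rintro y ⟨hy, hyc⟩
    simp only [SimpleGraph.Walk.support_cons, SimpleGraph.Walk.support_nil, List.mem_cons,
      List.not_mem_nil, or_false] at hy
    rcases hy with rfl | rfl | rfl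
    · exact absurd hyc ha
    · rfl
    · exact absurd hyc hb

/-- if `u, v` are false twins in a connected graph `G` and `G - u` has a
strong cfvc `k`-coloring `f`, then extending `f` by giving `u` the color of `v` yields
a strong cfvc `k`-coloring of `G`; in particular `G` is strongly cfvc `k`-colorable. -/
theorem strongCfvc_of_deleteFalseTwin {V : Type*} [DecidableEq V] (G : SimpleGraph V)
    (hG : G.Connected) (u v : V) (huv : u ≠ v)
    (htwin : G.neighborSet u = G.neighborSet v) (k : ℕ)
    (f : ({u}ᶜ : Set V) → Fin k) (hf : IsStrongCfvc (G.induce {u}ᶜ) f) :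
    IsStrongCfvc G
      (fun x => if hx : x = u then f ⟨v, by simp [Ne.symm huv]⟩ else f ⟨x, by simp [hx]⟩) ∧
    ∃ g : V → Fin k, IsStrongCfvc G g := by
  refine (fun h => ⟨h, _, h⟩) ?_
  have hadj (x : V) : G.Adj u x ↔ G.Adj v x := by
    simpa using congrArg (x ∈ ·) htwin
  have hnadj : ¬ G.Adj u v := fun h => G.irrefl ((hadj v).1 h)
  let r : G →g G.induce {u}ᶜ :=
    { toFun := fun x => if hx : x = u then ⟨v, huv.symm⟩ else ⟨x, hx⟩
      map_rel' := by
        intro a b hab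
        by_cases ha : a = u <;> by_cases hb : b = u
        · subst ha hb
          exact absurd hab G.irrefl
        · subst ha
          simpa [hb] using (hadj b).1 hab
        · subst hb
          simpa [ha] using ((hadj a).1 hab.symm).symm
        · simpa [ha, hb] using hab }
  let i : G.induce {u}ᶜ →g G := ⟨Subtype.val, id⟩
  let j : G.induce {u}ᶜ →g G :=
    { toFun := fun x => if x.1 = v then u else x.1
      map_rel' := by
        rintro ⟨a, ha⟩ ⟨b, hb⟩ hab
        replace hab : G.Adj a b := hab
        by_cases ha' : a = v <;> by_cases hb' : b = v
        · subst ha' hb'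
          exact absurd hab G.irrefl
        · subst ha'
          simpa [hb'] using (hadj b).2 hab
        · subst hb'
          simpa [ha'] using ((hadj a).2 hab.symm).symm
        · simpa [ha', hb'] using hab }
  have hri : Function.LeftInverse r i := fun x => dif_neg x.2
  have hrj : Function.LeftInverse r j := by
    rintro ⟨x, hx⟩
    by_cases hxv : x = v
    · subst hxv
      simp [r, j]
    · have hxu : x ≠ u := hx
      simp [r, j, hxv, hxu]
  have hcolor : (fun x => if hx : x = u then f ⟨v, by simp [Ne.symm huv]⟩
      else f ⟨x, by simp [hx]⟩) = f ∘ r := by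
    funext x
    by_cases hx : x = u <;> simp [r, hx]
  rw [hcolor]
  have hproper {a b : V} (hab : G.Adj a b) : (f ∘ r) a ≠ (f ∘ r) b :=
    hf.ne_of_adj (r.map_adj hab)
  have : Nontrivial V := ⟨u, v, huv⟩
  obtain ⟨w, huw⟩ := hG.preconnected.exists_adj_of_nontrivial u
  have hvw := (hadj w).1 huw
  have hjv : j ⟨v, huv.symm⟩ = u := if_pos rfl
  have hj {x : V} (hxu : x ≠ u) (hxv : x ≠ v) : j ⟨x, hxu⟩ = x := if_neg hxv
  intro a b hab
  by_cases ha : a = u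
  · subst ha
    by_cases hb : b = v
    · subst hb
      exact exists_path_of_common_neighbor hab hnadj huw hvw.symm (hproper huw) (hproper hvw)
    · have h := hf.exists_path_of_leftInverse j r hrj
        (a := ⟨v, huv.symm⟩) (b := ⟨b, hab.symm⟩) (fun h => hb (congrArg Subtype.val h).symm)
      rwa [hjv, hj hab.symm hb] at h
  · by_cases hb : b = u
    · subst hb
      by_cases ha' : a = v
      · subst ha'
        exact exists_path_of_common_neighbor hab (fun h => hnadj h.symm) hvw huw.symm
          (hproper hvw) (hproper huw)
      · have h := hf.exists_path_of_leftInverse j r hrj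
          (a := ⟨a, ha⟩) (b := ⟨v, huv.symm⟩) (fun h => ha' (congrArg Subtype.val h))
        rwa [hjv, hj ha ha'] at h
    · exact hf.exists_path_of_leftInverse i r hri
        (a := ⟨a, ha⟩) (b := ⟨b, hb⟩) (fun h => hab (congrArg Subtype.val h))
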